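/- Let L and M be disjoint finite sets each of cardinality N_s ≥ 1, let P be a finite set with a probability distribution π on P, and let V = {v₀, v₁}. Define the joint probability distribution Q on ((L ∪ M) × P) × V by: Q((ℓ,p), v₀) = Q((ℓ,p), v₁) = π(p)/(3N_s) for all ℓ ∈ L, p ∈ P; Q((m,p), v₀) = π(p)/(3N_s) and Q((m,p), v₁) = 0 for all m ∈ M, p ∈ P. Then the mutual information between the two factors equals I(Q) = log 3 - (4/3) log 2, and in particular I(Q) > 0. -/

import Mathlib

/-- Shannon entropy of a probability distribution on a finite set,
with the natural logarithm and the convention `0 * log 0 = 0`. -/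
noncomputable def shannonEntropy {S : Type*} [Fintype S] (p : S → ℝ) : ℝ :=
  -∑ i, p i * Real.log (p i)

/-- First marginal `(M₁Q)(x) = ∑_y Q(x,y)`. -/
noncomputable def marg1 {X Y : Type*} [Fintype Y] (Q : X × Y → ℝ) : X → ℝ :=
  fun x => ∑ y, Q (x, y)

/-- Second marginal `(M₂Q)(y) = ∑_x Q(x,y)`. -/
noncomputable def marg2 {X Y : Type*} [Fintype X] (Q : X × Y → ℝ) : Y → ℝ :=
  fun y => ∑ x, Q (x, y)

/-- Mutual information `I(Q) = H(M₁Q) + H(M₂Q) - H(Q)`. -/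
noncomputable def mutualInfo {X Y : Type*} [Fintype X] [Fintype Y] (Q : X × Y → ℝ) : ℝ :=
  shannonEntropy (marg1 Q) + shannonEntropy (marg2 Q) - shannonEntropy Q

/-- For the three-boxed Szilard engine after the conditional action:
`L` and `M` are disjoint finite sets of cells (disjoint union `L ⊕ M`), each of
cardinality `N_s ≥ 1`, `P` carries the thermal distribution `π`, and the auxiliary
particle has states `v₀ = false`, `v₁ = true`. The joint distribution `Q` with
`Q((ℓ,p),v₀) = Q((ℓ,p),v₁) = Q((m,p),v₀) = π(p)/(3N_s)` and `Q((m,p),v₁) = 0`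
has mutual information `I(Q) = log 3 - (4/3) log 2 > 0`. -/
theorem three_box_mutual_information {L M P : Type*}
    [Fintype L] [Fintype M] [Fintype P]
    (Ns : ℕ) (hNs : 1 ≤ Ns)
    (hL : Fintype.card L = Ns) (hM : Fintype.card M = Ns)
    (π : P → ℝ) (hπ0 : ∀ p, 0 ≤ π p) (hπ1 : ∑ p, π p = 1)
    (Q : ((L ⊕ M) × P) × Bool → ℝ)
    (hQl : ∀ (ℓ : L) (p : P) (b : Bool), Q ((Sum.inl ℓ, p), b) = π p / (3 * (Ns : ℝ)))
    (hQm0 : ∀ (m : M) (p : P), Q ((Sum.inr m, p), false) = π p / (3 * (Ns : ℝ)))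
    (hQm1 : ∀ (m : M) (p : P), Q ((Sum.inr m, p), true) = 0) :
    mutualInfo Q = Real.log 3 - (4 / 3) * Real.log 2 ∧ 0 < mutualInfo Q := by
  have hn : (Ns : ℝ) ≠ 0 := Nat.cast_ne_zero.mpr (by omega)
  have hlog (a : ℝ) : (a + a) * Real.log (a + a) = 2 * Real.log 2 * a + 2 * (a * Real.log a) := by
    rcases eq_or_ne a 0 with rfl | ha
    · simp
    · rw [← two_mul, Real.log_mul two_ne_zero ha]
      ring
  have hsum : ∑ p, π p / (3 * (Ns : ℝ)) = 1 / (3 * (Ns : ℝ)) := by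
    rw [← Finset.sum_div, hπ1]
  have hI : mutualInfo Q = Real.log 3 - (4 / 3) * Real.log 2 := by
    simp only [mutualInfo, shannonEntropy, marg1, marg2, Fintype.sum_prod_type,
      Fintype.sum_sum_type, Fintype.sum_bool, hQl, hQm0, hQm1, hlog, Finset.sum_add_distrib,
      ← Finset.mul_sum, hsum, Finset.sum_const, Finset.card_univ, hL, hM, nsmul_eq_mul,
      zero_add, zero_mul, mul_zero, add_zero]
    have h₁ : (Ns : ℝ) * (1 / (3 * (Ns : ℝ))) = 1 / 3 := by field_simp
    rw [h₁, Real.log_div one_ne_zero three_ne_zero, Real.log_one]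
    ring
  refine ⟨hI, ?_⟩
  have h : Real.log ((2 : ℝ) ^ 4) < Real.log ((3 : ℝ) ^ 3) :=
    Real.log_lt_log (by norm_num) (by norm_num)
  rw [Real.log_pow, Real.log_pow] at h
  push_cast at h
  rw [hI]
  linarith
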